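/- arXiv:2303.08165 — 2 statements merged into one kernel-verified Lean document; each statement's English description precedes it below -/
import Mathlib

section
/- Let k be a division ring, let (G_i)_{i∈I} be a family of groups, and let G = ∗_{i∈I} G_i be their free product (the coproduct in the category of groups). If for every i ∈ I there exist a division ring D_i and an injective ring homomorphism kG_i → D_i, then there exist a division ring D and an injective ring homomorphism kG → D. -/
namespace Submodule

open Module

variable {R M M' : Type*} [DivisionRing R] [AddCommGroup M] [Module R M] [AddCommGroup M']
  [Module R M']

theorem finrank_map_add_finrank_inf_ker (f : M →ₗ[R] M') (B : Submodule R M)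
    [FiniteDimensional R B] :
    finrank R (B.map f) + finrank R (B ⊓ LinearMap.ker f : Submodule R M) = finrank R B := by
  have h := LinearMap.finrank_range_add_finrank_ker (f.domRestrict B)
  rw [LinearMap.range_domRestrict] at h
  rw [← h, add_right_inj]
  have : (LinearMap.ker (f.domRestrict B)).map B.subtype = B ⊓ LinearMap.ker f := by
    rw [LinearMap.ker_domRestrict, Submodule.map_comap_subtype]
  rw [← this]
  exact (Submodule.equivMapOfInjective _ B.subtype_injective _).finrank_eq.symm

end Submodule

namespace SemilinearFamily

open Module CategoryTheory

variable {k ι : Type*} [DivisionRing k] {D : ι → Type*} [∀ i, DivisionRing (D i)]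
  {σ : ∀ i, k →+* D i}
  {K K' : Type*} [AddCommGroup K] [Module k K] [AddCommGroup K'] [Module k K']
  {X X' : ι → Type*} [∀ i, AddCommGroup (X i)] [∀ i, Module (D i) (X i)]
  [∀ i, AddCommGroup (X' i)] [∀ i, Module (D i) (X' i)]
  (α : ∀ i, K →ₛₗ[σ i] X i) (α' : ∀ i, K' →ₛₗ[σ i] X' i)

/-- The `D i`-span of the image of a `k`-subspace `B` under `α i`. -/
def hull (i : ι) (B : Submodule k K) : Submodule (D i) (X i) :=
  Submodule.span (D i) (α i '' B)

theorem hull_le_iff {i : ι} {B : Submodule k K} {Q : Submodule (D i) (X i)} :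
    hull α i B ≤ Q ↔ ∀ x ∈ B, α i x ∈ Q := by
  simp [hull, Submodule.span_le, Set.subset_def]

theorem mem_hull {i : ι} {B : Submodule k K} {x : K} (hx : x ∈ B) : α i x ∈ hull α i B :=
  Submodule.subset_span ⟨x, hx, rfl⟩

theorem hull_mono (i : ι) : Monotone (hull α i) := fun _ _ h =>
  (hull_le_iff α).2 fun _ hx => mem_hull α (h hx)

theorem hull_sup (i : ι) (B C : Submodule k K) : hull α i (B ⊔ C) = hull α i B ⊔ hull α i C := by
  refine le_antisymm ((hull_le_iff α).2 fun x hx => ?_)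
    (sup_le (hull_mono α i le_sup_left) (hull_mono α i le_sup_right))
  obtain ⟨y, hy, z, hz, rfl⟩ := Submodule.mem_sup.1 hx
  rw [map_add]
  exact Submodule.add_mem_sup (mem_hull α hy) (mem_hull α hz)

theorem hull_bot (i : ι) : hull α i ⊥ = ⊥ := by
  rw [eq_bot_iff, hull_le_iff]
  simp

theorem hull_span (i : ι) (s : Set K) :
    hull α i (Submodule.span k s) = Submodule.span (D i) (α i '' s) := by
  refine le_antisymm ((hull_le_iff α).2 fun x hx => ?_)
    (Submodule.span_mono (Set.image_mono Submodule.subset_span))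
  have : Submodule.span k s ≤ (Submodule.span (D i) (α i '' s)).comap (α i) :=
    Submodule.span_le.2 fun y hy => Submodule.subset_span ⟨y, hy, rfl⟩
  exact this hx

instance finiteDimensional_hull (i : ι) (B : Submodule k K) [FiniteDimensional k B] :
    FiniteDimensional (D i) (hull α i B) := by
  obtain ⟨s, hs⟩ := (Submodule.fg_iff_finiteDimensional B).2 inferInstance
  rw [← hs, hull_span]
  exact FiniteDimensional.span_of_finite _ (s.finite_toSet.image _)

theorem finrank_hull_le (i : ι) (B : Submodule k K) [FiniteDimensional k B] :
    finrank (D i) (hull α i B) ≤ finrank k B := by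
  let b := finBasis k B
  have hB : B = Submodule.span k (Set.range fun j => (b j : K)) := by
    have := congrArg (Submodule.map B.subtype) b.span_eq
    rw [Submodule.map_span, Submodule.map_top, Submodule.range_subtype, ← Set.range_comp] at this
    exact this.symm
  have : hull α i B = Submodule.span (D i) (Set.range fun j => α i (b j)) := by
    conv_lhs => rw [hB]
    rw [hull_span, ← Set.range_comp]
    rfl
  rw [this]
  exact (finrank_range_le_card _).trans (by simp)

theorem finrank_hull_add_finrank_le (i : ι) {B C : Submodule k K} [FiniteDimensional k C]
    (h : B ≤ C) :
    finrank (D i) (hull α i C) + finrank k B ≤ finrank (D i) (hull α i B) + finrank k C := by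
  have : FiniteDimensional k B := Submodule.finiteDimensional_of_le h
  obtain ⟨E, hE⟩ := Submodule.exists_isCompl B
  have hfd : FiniteDimensional k (E ⊓ C : Submodule k K) :=
    Submodule.finiteDimensional_of_le inf_le_right
  have hC : B ⊔ E ⊓ C = C := by rw [← sup_inf_assoc_of_le _ h, hE.sup_eq_top, top_inf_eq]
  have hd : B ⊓ (E ⊓ C) = ⊥ := by rw [← inf_assoc, hE.inf_eq_bot, bot_inf_eq]
  have h1 := Submodule.finrank_sup_add_finrank_inf_eq B (E ⊓ C)
  rw [hC, hd, finrank_bot] at h1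
  have h2 := Submodule.finrank_add_le_finrank_add_finrank (hull α i B) (hull α i (E ⊓ C))
  rw [← hull_sup, hC] at h2
  have := finrank_hull_le α i (E ⊓ C)
  omega

/-- The predimension of a finite-dimensional subspace `B` relative to a finite set of indices;
for finite `ι` and `F = univ` it is `∑ i, dim (hull i B) - (|ι| - 1) * dim B`. -/
noncomputable def predim (F : Finset ι) (B : Submodule k K) : ℤ :=
  finrank k B + ∑ i ∈ F, ((finrank (D i) (hull α i B) : ℤ) - finrank k B)

theorem predim_bot (F : Finset ι) : predim α F ⊥ = 0 := by
  have h (i : ι) : finrank (D i) (hull α i ⊥) = 0 := by rw [hull_bot, finrank_bot]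
  simp [predim, h]

theorem predim_sub_le {F F' : Finset ι} (hF : F ⊆ F') {B C : Submodule k K}
    [FiniteDimensional k C] (h : B ≤ C) :
    predim α F' C - predim α F' B ≤ predim α F C - predim α F B := by
  classical
  have : ∑ i ∈ F', (((finrank (D i) (hull α i C) : ℤ) - finrank k C) -
        ((finrank (D i) (hull α i B) : ℤ) - finrank k B)) ≤
      ∑ i ∈ F, (((finrank (D i) (hull α i C) : ℤ) - finrank k C) -
        ((finrank (D i) (hull α i B) : ℤ) - finrank k B)) := by
    rw [← Finset.sum_sdiff hF, add_le_iff_nonpos_left]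
    refine Finset.sum_nonpos fun i _ => ?_
    have := finrank_hull_add_finrank_le α i h
    omega
  simp only [Finset.sum_sub_distrib] at this
  simp only [predim, Finset.sum_sub_distrib]
  linarith

theorem predim_anti {F F' : Finset ι} (hF : F ⊆ F') (B : Submodule k K) [FiniteDimensional k B] :
    predim α F' B ≤ predim α F B := by
  simpa [predim_bot] using predim_sub_le α hF (bot_le : ⊥ ≤ B)

theorem predim_sup_add_predim_inf_le (F : Finset ι) (B C : Submodule k K)
    [FiniteDimensional k B] [FiniteDimensional k C] :
    predim α F (B ⊔ C) + predim α F (B ⊓ C) ≤ predim α F B + predim α F C := by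
  have h := Submodule.finrank_sup_add_finrank_inf_eq B C
  have : ∑ i ∈ F, (((finrank (D i) (hull α i (B ⊔ C)) : ℤ) - finrank k (B ⊔ C : Submodule k K)) +
        ((finrank (D i) (hull α i (B ⊓ C)) : ℤ) - finrank k (B ⊓ C : Submodule k K))) ≤
      ∑ i ∈ F, (((finrank (D i) (hull α i B) : ℤ) - finrank k B) +
        ((finrank (D i) (hull α i C) : ℤ) - finrank k C)) := by
    refine Finset.sum_le_sum fun i _ => ?_
    have h1 := Submodule.finrank_sup_add_finrank_inf_eq (hull α i B) (hull α i C)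
    rw [← hull_sup] at h1
    have h2 : hull α i (B ⊓ C) ≤ hull α i B ⊓ hull α i C :=
      le_inf (hull_mono α i inf_le_left) (hull_mono α i inf_le_right)
    have : FiniteDimensional (D i) (hull α i B ⊓ hull α i C : Submodule (D i) (X i)) :=
      Submodule.finiteDimensional_inf_left _ _
    have h3 := Submodule.finrank_mono h2
    omega
  simp only [Finset.sum_add_distrib] at this
  simp only [predim]
  linarith

/-- A `k`-linear map is a morphism `α ⟶ α'` if it extends to `D i`-linear maps for all `i`. -/
def IsMor (f : K →ₗ[k] K') : Prop :=
  ∀ i, ∃ g : X i →ₗ[D i] X' i, ∀ x, g (α i x) = α' i (f x)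

variable {α α'}

theorem IsMor.predim_map_add_le {f : K →ₗ[k] K'} (hf : IsMor α α' f) (F : Finset ι)
    (B : Submodule k K) [FiniteDimensional k B] :
    predim α' F (B.map f) + predim α F (B ⊓ LinearMap.ker f) ≤ predim α F B := by
  have h := Submodule.finrank_map_add_finrank_inf_ker f B
  have : ∑ i ∈ F, (((finrank (D i) (hull α' i (B.map f)) : ℤ) - finrank k (B.map f)) +
        ((finrank (D i) (hull α i (B ⊓ LinearMap.ker f)) : ℤ) -
          finrank k (B ⊓ LinearMap.ker f : Submodule k K))) ≤
      ∑ i ∈ F, ((finrank (D i) (hull α i B) : ℤ) - finrank k B) := by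
    refine Finset.sum_le_sum fun i _ => ?_
    obtain ⟨g, hg⟩ := hf i
    have h1 := Submodule.finrank_map_add_finrank_inf_ker g (hull α i B)
    have h2 : hull α i (B ⊓ LinearMap.ker f) ≤ hull α i B ⊓ LinearMap.ker g := by
      refine le_inf (hull_mono α i inf_le_left) ((hull_le_iff α).2 fun x hx => ?_)
      rw [LinearMap.mem_ker, hg, LinearMap.mem_ker.1 hx.2, map_zero]
    have h3 : hull α' i (B.map f) ≤ (hull α i B).map g := by
      rw [hull_le_iff]
      rintro _ ⟨x, hx, rfl⟩
      exact ⟨α i x, mem_hull α hx, hg x⟩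
    have : FiniteDimensional (D i) (hull α i B ⊓ LinearMap.ker g : Submodule (D i) (X i)) :=
      Submodule.finiteDimensional_inf_left _ _
    have h4 := Submodule.finrank_mono h2
    have h5 := Submodule.finrank_mono h3
    omega
  simp only [Finset.sum_add_distrib] at this
  simp only [predim]
  linarith

variable (α)

/-- All nonzero finite-dimensional subspaces have positive predimension. -/
def TorsionFree : Prop :=
  ∀ (F : Finset ι) (B : Submodule k K), FiniteDimensional k B → B ≠ ⊥ → 1 ≤ predim α F B

/-- `v` is algebraic over `u` if both lie in a subspace of predimension at most one. -/
def IsAlgebraicOver (u v : K) : Prop :=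
  ∃ (F : Finset ι) (B : Submodule k K),
    FiniteDimensional k B ∧ u ∈ B ∧ v ∈ B ∧ predim α F B ≤ 1

/-- Everything is algebraic over a single nonzero vector. -/
def RankOne : Prop := ∃ u : K, u ≠ 0 ∧ ∀ v, IsAlgebraicOver α u v

variable {α}

theorem TorsionFree.predim_nonneg (h : TorsionFree α) (F : Finset ι) (B : Submodule k K)
    [hB : FiniteDimensional k B] : 0 ≤ predim α F B := by
  by_cases hb : B = ⊥
  · rw [hb, predim_bot]
  · exact zero_le_one.trans (h F B hB hb)

theorem TorsionFree.predim_sup_le_one [DecidableEq ι] (h : TorsionFree α) {F F' : Finset ι}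
    {B C : Submodule k K}
    [FiniteDimensional k B] [FiniteDimensional k C] {x : K} (hx : x ≠ 0) (hB : x ∈ B) (hC : x ∈ C)
    (h1 : predim α F B ≤ 1) (h2 : predim α F' C ≤ 1) : predim α (F ∪ F') (B ⊔ C) ≤ 1 := by
  have h3 := predim_sup_add_predim_inf_le α (F ∪ F') B C
  have h4 := h (F ∪ F') (B ⊓ C) (Submodule.finiteDimensional_inf_left _ _)
    ((Submodule.ne_bot_iff _).2 ⟨x, ⟨hB, hC⟩, hx⟩)
  have h5 := predim_anti α (Finset.subset_union_left : F ⊆ F ∪ F') B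
  have h6 := predim_anti α (Finset.subset_union_right : F' ⊆ F ∪ F') C
  linarith

theorem TorsionFree.isAlgebraicOver_trans (h : TorsionFree α) {u v w : K} (hv : v ≠ 0)
    (huv : IsAlgebraicOver α u v) (hvw : IsAlgebraicOver α v w) : IsAlgebraicOver α u w := by
  classical
  obtain ⟨F, B, _, huB, hvB, hB⟩ := huv
  obtain ⟨F', C, _, hvC, hwC, hC⟩ := hvw
  exact ⟨F ∪ F', B ⊔ C, inferInstance, Submodule.mem_sup_left huB, Submodule.mem_sup_right hwC,
    h.predim_sup_le_one hv hvB hvC hB hC⟩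

theorem predim_span_singleton_le (F : Finset ι) (u : K) :
    predim α F (Submodule.span k {u}) ≤ 1 := by
  have h := predim_anti α (Finset.empty_subset F) (Submodule.span k {u})
  have h2 := finrank_span_le_card (R := k) ({u} : Set K)
  simp only [predim, Finset.sum_empty, add_zero] at h
  simp only [Set.toFinset_singleton, Finset.card_singleton] at h2
  simp only [predim] at *
  omega

/-- The vectors algebraic over a nonzero vector `u`. -/
def TorsionFree.closure (h : TorsionFree α) {u : K} (hu : u ≠ 0) : Submodule k K where
  carrier := {v | IsAlgebraicOver α u v}
  zero_mem' := ⟨∅, Submodule.span k {u}, inferInstance, Submodule.mem_span_singleton_self u,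
    zero_mem _, predim_span_singleton_le _ _⟩
  add_mem' := by
    classical
    rintro v w ⟨F, B, _, huB, hvB, hB⟩ ⟨F', C, _, huC, hwC, hC⟩
    exact ⟨F ∪ F', B ⊔ C, inferInstance, Submodule.mem_sup_left huB, Submodule.add_mem_sup hvB hwC,
      h.predim_sup_le_one hu huB huC hB hC⟩
  smul_mem' := by
    rintro c v ⟨F, B, hfd, huB, hvB, hB⟩
    exact ⟨F, B, hfd, huB, B.smul_mem c hvB, hB⟩

theorem TorsionFree.mem_closure (h : TorsionFree α) {u v : K} (hu : u ≠ 0) :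
    v ∈ h.closure hu ↔ IsAlgebraicOver α u v := Iff.rfl

theorem le_closure (h : TorsionFree α) {u : K} (hu : u ≠ 0) {F : Finset ι} {B : Submodule k K}
    [hB : FiniteDimensional k B] (huB : u ∈ B) (h1 : predim α F B ≤ 1) : B ≤ h.closure hu :=
  fun _ hv => ⟨F, B, hB, huB, hv, h1⟩

theorem self_mem_closure (h : TorsionFree α) {u : K} (hu : u ≠ 0) : u ∈ h.closure hu :=
  le_closure h hu (Submodule.mem_span_singleton_self u) (predim_span_singleton_le ∅ u)
    (Submodule.mem_span_singleton_self u)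

theorem exists_predim_le_one_of_le_closure (h : TorsionFree α) {u : K} (hu : u ≠ 0)
    (B : Submodule k K) [FiniteDimensional k B] (hB : B ≤ h.closure hu) :
    ∃ (F : Finset ι) (C : Submodule k K),
      FiniteDimensional k C ∧ u ∈ C ∧ B ≤ C ∧ predim α F C ≤ 1 := by
  classical
  obtain ⟨s, rfl⟩ := (Submodule.fg_iff_finiteDimensional B).2 inferInstance
  rw [Submodule.span_le] at hB
  simp only [Submodule.span_le]
  induction s using Finset.induction_on with
  | empty =>
    exact ⟨∅, Submodule.span k {u}, inferInstance, Submodule.mem_span_singleton_self u,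
      by simp, predim_span_singleton_le _ _⟩
  | insert v s _ ih =>
    rw [Finset.coe_insert, Set.insert_subset_iff] at hB
    obtain ⟨F, C, _, huC, hsC, hC⟩ := ih hB.2
    obtain ⟨F', C', _, huC', hvC', hC'⟩ := hB.1
    refine ⟨F ∪ F', C ⊔ C', inferInstance, Submodule.mem_sup_left huC, ?_,
      h.predim_sup_le_one hu huC huC' hC hC'⟩
    rw [Finset.coe_insert, Set.insert_subset_iff]
    exact ⟨Submodule.mem_sup_right hvC', hsC.trans (le_sup_left : C ≤ C ⊔ C')⟩

theorem RankOne.exists_predim_le_one (h : TorsionFree α) (h' : RankOne α)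
    (B : Submodule k K) [FiniteDimensional k B] :
    ∃ (F : Finset ι) (C : Submodule k K), FiniteDimensional k C ∧ B ≤ C ∧ predim α F C ≤ 1 := by
  obtain ⟨u, hu, hcl⟩ := h'
  obtain ⟨F, C, hfd, -, hBC, hC⟩ :=
    exists_predim_le_one_of_le_closure h hu B fun v _ => hcl v
  exact ⟨F, C, hfd, hBC, hC⟩

theorem IsMor.injective_of_ne_zero {f : K →ₗ[k] K'} (hf : IsMor α α' f) (h : TorsionFree α)
    (h1 : RankOne α) (h' : TorsionFree α') (hne : f ≠ 0) : Function.Injective f := by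
  rw [← LinearMap.ker_eq_bot, Submodule.eq_bot_iff]
  by_contra! ⟨x, hx, hx0⟩
  obtain ⟨y, hy⟩ : ∃ y, f y ≠ 0 := by
    by_contra! hc
    exact hne (LinearMap.ext hc)
  have : FiniteDimensional k (Submodule.span k {x, y}) :=
    FiniteDimensional.span_of_finite k (by simp)
  obtain ⟨F, C, _, hBC, hC⟩ := h1.exists_predim_le_one h (Submodule.span k {x, y})
  have hxC : x ∈ C := hBC (Submodule.subset_span (by simp))
  have hyC : y ∈ C := hBC (Submodule.subset_span (by simp))
  have e1 := hf.predim_map_add_le F C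
  have e2 := h' F (C.map f) inferInstance
    ((Submodule.ne_bot_iff _).2 ⟨f y, ⟨y, hyC, rfl⟩, hy⟩)
  have e3 := h F (C ⊓ LinearMap.ker f) (Submodule.finiteDimensional_inf_left _ _)
    ((Submodule.ne_bot_iff _).2 ⟨x, ⟨hxC, hx⟩, hx0⟩)
  linarith

end SemilinearFamily

namespace Submodule

open Module

variable {R M : Type*} [DivisionRing R] [AddCommGroup M] [Module R M]

theorem finrank_map_mkQ {N B C : Submodule R M} [FiniteDimensional R B] [FiniteDimensional R C]
    (hCN : C ≤ N) (hBC : B ⊓ N ≤ C) :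
    (finrank R (B.map N.mkQ) : ℤ) = finrank R (B ⊔ C : Submodule R M) - finrank R C := by
  have h1 := Submodule.finrank_map_add_finrank_inf_ker N.mkQ (B ⊔ C)
  have h2 : (B ⊔ C).map N.mkQ = B.map N.mkQ := by
    rw [Submodule.map_sup, sup_eq_left]
    rintro _ ⟨x, hx, rfl⟩
    have hx0 : N.mkQ x = 0 := (Submodule.Quotient.mk_eq_zero N).2 (hCN hx)
    rw [hx0]
    exact zero_mem _
  have h3 : (B ⊔ C) ⊓ N = C := by
    rw [sup_comm, sup_inf_assoc_of_le _ hCN, sup_eq_left]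
    exact hBC
  rw [Submodule.ker_mkQ, h2, h3] at h1
  omega

theorem exists_finiteDimensional_map_mkQ_eq (N : Submodule R M) (Q : Submodule R (M ⧸ N))
    [hQ : FiniteDimensional R Q] :
    ∃ B : Submodule R M, FiniteDimensional R B ∧ B.map N.mkQ = Q := by
  obtain ⟨s, rfl⟩ := (Submodule.fg_iff_finiteDimensional Q).2 hQ
  refine ⟨Submodule.span R (Function.surjInv N.mkQ_surjective '' s),
    FiniteDimensional.span_of_finite R (s.finite_toSet.image _), ?_⟩
  rw [Submodule.map_span, Set.image_image]
  simp only [Function.surjInv_eq, Set.image_id']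

end Submodule

namespace SemilinearFamily

open Module CategoryTheory

variable {k ι : Type*} [DivisionRing k] {D : ι → Type*} [∀ i, DivisionRing (D i)]
  {σ : ∀ i, k →+* D i}
  {K K' L : Type*} [AddCommGroup K] [Module k K] [AddCommGroup K'] [Module k K']
  [AddCommGroup L] [Module k L]
  {X X' Y : ι → Type*} [∀ i, AddCommGroup (X i)] [∀ i, Module (D i) (X i)]
  [∀ i, AddCommGroup (X' i)] [∀ i, Module (D i) (X' i)]
  [∀ i, AddCommGroup (Y i)] [∀ i, Module (D i) (Y i)]
  (α : ∀ i, K →ₛₗ[σ i] X i) (α' : ∀ i, K' →ₛₗ[σ i] X' i) (β : ∀ i, L →ₛₗ[σ i] Y i)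

variable {α α' β} in
theorem IsMor.comp {f : K →ₗ[k] K'} {g : K' →ₗ[k] L} (hg : IsMor α' β g) (hf : IsMor α α' f) :
    IsMor α β (g ∘ₗ f) := fun i => by
  obtain ⟨a, ha⟩ := hf i
  obtain ⟨b, hb⟩ := hg i
  exact ⟨b ∘ₗ a, fun x => by simp [ha, hb]⟩

theorem isMor_id : IsMor α α LinearMap.id := fun _ => ⟨LinearMap.id, fun _ => rfl⟩

/-- The morphisms form an additive group. -/
def homs : AddSubgroup (K →ₗ[k] K') where
  carrier := {f | IsMor α α' f}
  zero_mem' _ := ⟨0, fun x => by simp⟩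
  add_mem' hf hg i := by
    obtain ⟨a, ha⟩ := hf i
    obtain ⟨b, hb⟩ := hg i
    exact ⟨a + b, fun x => by simp [ha, hb]⟩
  neg_mem' hf i := by
    obtain ⟨a, ha⟩ := hf i
    exact ⟨-a, fun x => by simp [ha]⟩

/-- The direct sum of two families. -/
def prod (i : ι) : K × K' →ₛₗ[σ i] X i × X' i where
  toFun p := (α i p.1, α' i p.2)
  map_add' _ _ := by simp
  map_smul' _ _ := by simp

theorem isMor_fst : IsMor (prod α α') α (LinearMap.fst k K K') := fun _ =>
  ⟨LinearMap.fst _ _ _, fun _ => rfl⟩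

theorem isMor_snd : IsMor (prod α α') α' (LinearMap.snd k K K') := fun _ =>
  ⟨LinearMap.snd _ _ _, fun _ => rfl⟩

theorem isMor_inl : IsMor α (prod α α') (LinearMap.inl k K K') := fun i =>
  ⟨LinearMap.inl _ _ _, fun _ => by simp [prod]⟩

theorem isMor_inr : IsMor α' (prod α α') (LinearMap.inr k K K') := fun i =>
  ⟨LinearMap.inr _ _ _, fun _ => by simp [prod]⟩

variable {α α'} in
theorem TorsionFree.prod (h : TorsionFree α) (h' : TorsionFree α') :
    TorsionFree (prod α α') := by
  intro F B _ hB
  have : FiniteDimensional k (B ⊓ LinearMap.ker (LinearMap.snd k K K') : Submodule k (K × K')) :=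
    Submodule.finiteDimensional_inf_left _ _
  have e1 := (isMor_snd α α').predim_map_add_le F B
  have e2 := (isMor_fst α α').predim_map_add_le F (B ⊓ LinearMap.ker (LinearMap.snd k K K'))
  have hbot : B ⊓ LinearMap.ker (LinearMap.snd k K K') ⊓ LinearMap.ker (LinearMap.fst k K K')
      = ⊥ := by
    rw [eq_bot_iff]
    rintro ⟨a, b⟩ ⟨⟨-, h1⟩, h2⟩
    exact Prod.ext h2 h1
  rw [hbot, predim_bot, add_zero] at e2
  by_cases hsnd : B.map (LinearMap.snd k K K') = ⊥
  · have hfst : (B ⊓ LinearMap.ker (LinearMap.snd k K K')).map (LinearMap.fst k K K') ≠ ⊥ := by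
      intro hc
      refine hB (eq_bot_iff.2 fun x hx => ?_)
      have hx2 : x ∈ LinearMap.ker (LinearMap.snd k K K') :=
        (Submodule.mem_bot k).1 (hsnd ▸ Submodule.mem_map_of_mem hx)
      have hx1 : x ∈ LinearMap.ker (LinearMap.fst k K K') :=
        (Submodule.mem_bot k).1 (hc ▸ Submodule.mem_map_of_mem ⟨hx, hx2⟩)
      rw [← hbot]
      exact ⟨⟨hx, hx2⟩, hx1⟩
    have e3 := h F _ inferInstance hfst
    have e4 := h'.predim_nonneg F (B.map (LinearMap.snd k K K'))
    linarith
  · have e3 := h' F _ inferInstance hsnd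
    have e4 := h.predim_nonneg F
      ((B ⊓ LinearMap.ker (LinearMap.snd k K K')).map (LinearMap.fst k K K'))
    linarith

variable {α α'} in
theorem IsMor.predim_map_le {f : K →ₗ[k] K'} (hf : IsMor α α' f) (h : TorsionFree α)
    (F : Finset ι) (B : Submodule k K) [FiniteDimensional k B] :
    predim α' F (B.map f) ≤ predim α F B := by
  have : FiniteDimensional k (B ⊓ LinearMap.ker f : Submodule k K) :=
    Submodule.finiteDimensional_inf_left _ _
  have e1 := hf.predim_map_add_le F B
  have e2 := h.predim_nonneg F (B ⊓ LinearMap.ker f)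
  linarith

section Quotient

variable (N : Submodule k K)

/-- The family induced on the quotient by a subspace. -/
def quotient (i : ι) : K ⧸ N →ₛₗ[σ i] X i ⧸ hull α i N :=
  N.mapQ (hull α i N) (α i) fun _ hx => mem_hull α hx

theorem isMor_mkQ : IsMor α (quotient α N) N.mkQ := fun i =>
  ⟨(hull α i N).mkQ, fun _ => rfl⟩

theorem hull_quotient_map (i : ι) (B : Submodule k K) :
    hull (quotient α N) i (B.map N.mkQ) = (hull α i B).map (hull α i N).mkQ := by
  refine le_antisymm ((hull_le_iff _).2 ?_) (Submodule.map_le_iff_le_comap.2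
    ((hull_le_iff α).2 fun x hx => ?_))
  · rintro _ ⟨x, hx, rfl⟩
    exact ⟨α i x, mem_hull α hx, rfl⟩
  · exact mem_hull (quotient α N) (Submodule.mem_map_of_mem (f := N.mkQ) hx)

theorem exists_finiteDimensional_inf_hull_le (i : ι) (P : Submodule (D i) (X i))
    [FiniteDimensional (D i) P] :
    ∃ C : Submodule k K, FiniteDimensional k C ∧ C ≤ N ∧ P ⊓ hull α i N ≤ hull α i C := by
  classical
  obtain ⟨s, hs⟩ := (Submodule.fg_iff_finiteDimensional (P ⊓ hull α i N)).2
    (Submodule.finiteDimensional_inf_left _ _)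
  have hsN : (s : Set (X i)) ⊆ Submodule.span (D i) (α i '' N) := by
    rw [← Submodule.span_le, hs]
    exact inf_le_right
  obtain ⟨t, htN, hst⟩ := Submodule.subset_span_finite_of_subset_span hsN
  obtain ⟨t', ht', rfl⟩ := Finset.subset_set_image_iff.1 htN
  refine ⟨Submodule.span k t', FiniteDimensional.span_of_finite k t'.finite_toSet,
    Submodule.span_le.2 ht', ?_⟩
  rw [← hs, hull_span, ← Finset.coe_image]
  exact Submodule.span_le.2 hst

/-- If the finite-dimensional subspace `C` is large enough compared to `B`, then the image of `B`
in the quotient has the expected predimension. -/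
theorem predim_quotient_map (F : Finset ι) {B C : Submodule k K} [FiniteDimensional k B]
    [FiniteDimensional k C] (hCN : C ≤ N) (hBC : B ⊓ N ≤ C)
    (hF : ∀ i ∈ F, hull α i B ⊓ hull α i N ≤ hull α i C) :
    predim (quotient α N) F (B.map N.mkQ) = predim α F (B ⊔ C) - predim α F C := by
  have hX (i : ι) (hi : i ∈ F) :
      (finrank (D i) (hull (quotient α N) i (B.map N.mkQ)) : ℤ) =
        finrank (D i) (hull α i (B ⊔ C)) - finrank (D i) (hull α i C) := by
    rw [hull_quotient_map, hull_sup]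
    exact Submodule.finrank_map_mkQ (hull_mono α i hCN) (hF i hi)
  have : ∑ i ∈ F, ((finrank (D i) (hull (quotient α N) i (B.map N.mkQ)) : ℤ)
        - finrank k (B.map N.mkQ)) =
      ∑ i ∈ F, (((finrank (D i) (hull α i (B ⊔ C)) : ℤ) - finrank k (B ⊔ C : Submodule k K))
        - ((finrank (D i) (hull α i C) : ℤ) - finrank k C)) := by
    refine Finset.sum_congr rfl fun i hi => ?_
    rw [hX i hi, Submodule.finrank_map_mkQ hCN hBC]
    ring
  rw [predim, this, Submodule.finrank_map_mkQ hCN hBC, Finset.sum_sub_distrib]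
  simp only [predim]
  ring

variable {α N} in
theorem TorsionFree.quotient_closure (h : TorsionFree α) {u : K} (hu : u ≠ 0) :
    TorsionFree (quotient α (h.closure hu)) := by
  classical
  intro F Bq hfd hne
  obtain ⟨B, _, rfl⟩ := Submodule.exists_finiteDimensional_map_mkQ_eq _ Bq
  choose C hCfd hCN hC using fun i =>
    exists_finiteDimensional_inf_hull_le α (h.closure hu) i (hull α i B)
  have : FiniteDimensional k (B ⊓ h.closure hu : Submodule k K) :=
    Submodule.finiteDimensional_inf_left _ _
  obtain ⟨F', E, _, huE, hE, hE1⟩ := exists_predim_le_one_of_le_closure h hu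
    (B ⊓ h.closure hu ⊔ F.sup C) (sup_le inf_le_right (Finset.sup_le fun i _ => hCN i))
  rw [predim_quotient_map α (h.closure hu) F (le_closure h hu huE hE1) (le_sup_left.trans hE)
    fun i hi =>
    (hC i).trans (hull_mono α i ((Finset.le_sup hi).trans (le_sup_right.trans hE)))]
  have e1 := predim_sub_le α (Finset.subset_union_left : F ⊆ F ∪ F') (le_sup_right : E ≤ B ⊔ E)
  have e2 := predim_anti α (Finset.subset_union_right : F' ⊆ F ∪ F') E
  have e3 : 1 < predim α (F ∪ F') (B ⊔ E) := by
    by_contra! hle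
    refine hne (LinearMap.le_ker_iff_map.1 ?_)
    rw [Submodule.ker_mkQ]
    exact le_sup_left.trans (le_closure h hu (Submodule.mem_sup_right huE) hle)
  linarith

theorem predim_quotient_closure_map_lt (h : TorsionFree α) {u : K} (hu : u ≠ 0) (F : Finset ι)
    (B : Submodule k K) [FiniteDimensional k B] (huB : u ∈ B) :
    predim (quotient α (h.closure hu)) F (B.map (h.closure hu).mkQ) + 1 ≤ predim α F B := by
  have e1 := (isMor_mkQ α (h.closure hu)).predim_map_add_le F B
  have e2 := h F (B ⊓ LinearMap.ker (h.closure hu).mkQ) (Submodule.finiteDimensional_inf_left _ _)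
    ((Submodule.ne_bot_iff _).2
      ⟨u, ⟨huB, by rw [Submodule.ker_mkQ]; exact self_mem_closure h hu⟩, hu⟩)
  linarith

end Quotient

variable {α α' β}

/-- Two nonzero morphisms out of a torsion-free rank one object can be completed to a commutative
square of nonzero morphisms. -/
theorem exists_quotient_prod_square (h : TorsionFree α) (h1 : RankOne α)
    (h' : TorsionFree α') (h1' : RankOne α') (hβ : TorsionFree β) (h1β : RankOne β)
    {f : K →ₗ[k] K'} {g : K →ₗ[k] L} (hf : IsMor α α' f) (hg : IsMor α β g) (hf0 : f ≠ 0)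
    (hg0 : g ≠ 0) :
    ∃ N : Submodule k (K' × L), TorsionFree (quotient (prod α' β) N) ∧
      RankOne (quotient (prod α' β) N) ∧
      N.mkQ ∘ₗ LinearMap.inl k K' L ∘ₗ f = N.mkQ ∘ₗ LinearMap.inr k K' L ∘ₗ g ∧
      N.mkQ ∘ₗ LinearMap.inr k K' L ≠ 0 := by
  classical
  obtain ⟨x₀, hx₀, hcl⟩ := id h1
  have hfx : f x₀ ≠ 0 := fun hc => hx₀ (hf.injective_of_ne_zero h h1 h' hf0 (by simpa using hc))
  have hgx : g x₀ ≠ 0 := fun hc => hx₀ (hg.injective_of_ne_zero h h1 hβ hg0 (by simpa using hc))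
  have hV := h'.prod hβ
  have hu : (f x₀, - g x₀) ≠ 0 := fun hc => hfx (congrArg Prod.fst hc)
  have hφ : IsMor α (prod α' β) (f.prod (-g)) := fun i => by
    obtain ⟨a, ha⟩ := hf i
    obtain ⟨b, hb⟩ := hg i
    exact ⟨a.prod (-b), fun x => by simp [prod, ha, hb]⟩
  have hsq : (hV.closure hu).mkQ ∘ₗ LinearMap.inl k K' L ∘ₗ f =
      (hV.closure hu).mkQ ∘ₗ LinearMap.inr k K' L ∘ₗ g := by
    ext x
    obtain ⟨F, B, _, hxB, hyB, hB⟩ := hcl x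
    refine (Submodule.Quotient.eq _).2 (le_closure hV hu (B := B.map (f.prod (-g))) (F := F)
      ⟨x₀, hxB, rfl⟩ ((hφ.predim_map_le h F B).trans hB) ⟨x, hyB, ?_⟩)
    simp
  have hp : (hV.closure hu).mkQ (0, g x₀) ≠ 0 := by
    intro hc
    obtain ⟨F, B, _, huB, hpB, hB⟩ := (Submodule.Quotient.mk_eq_zero _).1 hc
    have e1 := (isMor_fst α' β).predim_map_add_le F B
    have e2 := hV F (B ⊓ LinearMap.ker (LinearMap.fst k K' L))
      (Submodule.finiteDimensional_inf_left _ _)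
      ((Submodule.ne_bot_iff _).2 ⟨(0, g x₀), ⟨hpB, rfl⟩, fun hc => hgx (congrArg Prod.snd hc)⟩)
    have e3 := h' F (B.map (LinearMap.fst k K' L)) inferInstance
      ((Submodule.ne_bot_iff _).2 ⟨f x₀, ⟨_, huB, rfl⟩, hfx⟩)
    linarith
  refine ⟨hV.closure hu, hV.quotient_closure hu, ⟨_, hp, fun v => ?_⟩, hsq, fun hc => hp
    (LinearMap.congr_fun hc (g x₀))⟩
  obtain ⟨⟨y, z⟩, rfl⟩ := (hV.closure hu).mkQ_surjective v
  have : FiniteDimensional k (Submodule.span k {f x₀, y}) :=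
    FiniteDimensional.span_of_finite k (by simp)
  have : FiniteDimensional k (Submodule.span k {g x₀, z}) :=
    FiniteDimensional.span_of_finite k (by simp)
  obtain ⟨F, B, _, hB, hB1⟩ := h1'.exists_predim_le_one h' (Submodule.span k {f x₀, y})
  obtain ⟨F', C, _, hC, hC1⟩ := h1β.exists_predim_le_one hβ (Submodule.span k {g x₀, z})
  rw [Submodule.span_le, Set.insert_subset_iff, Set.singleton_subset_iff] at hB hC
  set E := B.map (LinearMap.inl k K' L) ⊔ C.map (LinearMap.inr k K' L)
  have hE {a : K'} {b : L} (ha : a ∈ B) (hb : b ∈ C) : (a, b) ∈ E := by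
    have := Submodule.add_mem_sup (Submodule.mem_map_of_mem (f := LinearMap.inl k K' L) ha)
      (Submodule.mem_map_of_mem (f := LinearMap.inr k K' L) hb)
    convert this using 1
    simp
  refine ⟨F ∪ F', E.map (hV.closure hu).mkQ, inferInstance,
    Submodule.mem_map_of_mem (hE B.zero_mem hC.1), Submodule.mem_map_of_mem (hE hB.2 hC.2), ?_⟩
  have e1 := predim_quotient_closure_map_lt (prod α' β) hV hu (F ∪ F') E
    (hE hB.1 (C.neg_mem hC.1))
  have e2 := predim_sup_add_predim_inf_le (prod α' β) (F ∪ F') (B.map (LinearMap.inl k K' L))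
    (C.map (LinearMap.inr k K' L))
  have : FiniteDimensional k (B.map (LinearMap.inl k K' L) ⊓ C.map (LinearMap.inr k K' L) :
    Submodule k (K' × L)) := Submodule.finiteDimensional_inf_left _ _
  have e3 := hV.predim_nonneg (F ∪ F')
    (B.map (LinearMap.inl k K' L) ⊓ C.map (LinearMap.inr k K' L))
  have e4 := (isMor_inl α' β).predim_map_le h' (F ∪ F') B
  have e5 := (isMor_inr α' β).predim_map_le hβ (F ∪ F') C
  have e6 := predim_anti α' (Finset.subset_union_left : F ⊆ F ∪ F') B
  have e7 := predim_anti β (Finset.subset_union_right : F' ⊆ F ∪ F') C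
  linarith

end SemilinearFamily

namespace CategoryTheory.Preadditive

universe v u

variable (C : Type u) [Category.{v} C] [Preadditive C]

/-- The nonzero morphisms of a preadditive category. -/
def nonzero : MorphismProperty C := fun _ _ f => f ≠ 0

variable {C}

theorem nonzero_hasLeftCalculusOfFractions (hid : ∀ X : C, 𝟙 X ≠ 0)
    (hcomp : ∀ {X Y Z : C} {f : X ⟶ Y} {g : Y ⟶ Z}, f ≠ 0 → g ≠ 0 → f ≫ g ≠ 0)
    (hore : ∀ {X Y Z : C} {f : X ⟶ Y} {g : X ⟶ Z}, f ≠ 0 → g ≠ 0 →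
      ∃ (T : C) (a : Y ⟶ T) (b : Z ⟶ T), f ≫ a = g ≫ b ∧ b ≠ 0) :
    (nonzero C).HasLeftCalculusOfFractions where
  id_mem := hid
  comp_mem _ _ hf hg := hcomp hf hg
  exists_leftFraction X Y φ := by
    by_cases hf : φ.f = 0
    · exact ⟨⟨0, 𝟙 Y, hid Y⟩, by simp [hf]⟩
    · obtain ⟨T, a, b, hab, hb⟩ := hore φ.hs hf
      exact ⟨⟨a, b, hb⟩, hab.symm⟩
  ext X' X Y f₁ f₂ s hs h := by
    refine ⟨Y, 𝟙 Y, hid Y, ?_⟩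
    by_contra hne
    rw [Category.comp_id, Category.comp_id, ← sub_eq_zero] at hne
    exact hcomp hs hne (by rw [comp_sub, h, sub_self])

theorem exists_divisionRing_of_hasLeftCalculusOfFractions
    [(nonzero C).HasLeftCalculusOfFractions] (X : C) :
    ∃ (E : Type (max u v)) (_ : DivisionRing E) (f : End X →+* E), Function.Injective f := by
  have hinj : ∀ {Y Z : C} {f g : Y ⟶ Z}, (nonzero C).Q.map f = (nonzero C).Q.map g → f = g := by
    intro Y Z f g h
    obtain ⟨T, s, hs, hfg⟩ :=
      (MorphismProperty.map_eq_iff_postcomp (nonzero C).Q (nonzero C) f g).1 h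
    by_contra hne
    exact (nonzero C).comp_mem _ _ (show (nonzero C) (f - g) from sub_ne_zero.2 hne) hs
      (by rw [sub_comp, hfg, sub_self])
  let φ : End X →+* End ((nonzero C).Q.obj X) :=
    { (nonzero C).Q.mapEnd X with
      map_zero' := (nonzero C).Q.map_zero X X
      map_add' := fun f g => (nonzero C).Q.map_add (f := f) (g := g) }
  have hφ : Function.Injective φ := fun f g h => hinj h
  have : Nontrivial (End X) :=
    ⟨1, 0, (nonzero C).id_mem X⟩
  have : Nontrivial (End ((nonzero C).Q.obj X)) := hφ.nontrivial
  have hunit (a : End ((nonzero C).Q.obj X)) : IsUnit a ∨ a = 0 := by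
    obtain ⟨z, hz⟩ := Localization.exists_leftFraction (nonzero C).Q (nonzero C) a
    by_cases hf : z.f = 0
    · right
      rw [hz, MorphismProperty.LeftFraction.map, hf, Functor.map_zero, Limits.zero_comp]
    · left
      have : IsIso ((nonzero C).Q.map z.f) := Localization.inverts (nonzero C).Q (nonzero C) _ hf
      rw [isUnit_iff_isIso, hz, MorphismProperty.LeftFraction.map]
      infer_instance
  exact ⟨_, DivisionRing.ofIsUnitOrEqZero hunit, φ, hφ⟩

end CategoryTheory.Preadditive

namespace SemilinearFamily

open Module CategoryTheory

universe t a b c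

variable {k : Type a} {ι : Type b} [DivisionRing k] {D : ι → Type c} [∀ i, DivisionRing (D i)]

/-- Bundled torsion-free families of rank one. -/
structure RankOneObj (σ : ∀ i, k →+* D i) where
  /-- The underlying `k`-space. -/
  K : Type t
  /-- The target `D i`-spaces. -/
  X : ι → Type t
  [addCommGroup : AddCommGroup K]
  [module : Module k K]
  [addCommGroupX : ∀ i, AddCommGroup (X i)]
  [moduleX : ∀ i, Module (D i) (X i)]
  /-- The semilinear maps. -/
  α : ∀ i, K →ₛₗ[σ i] X i
  torsionFree : TorsionFree α
  rankOne : RankOne α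

namespace RankOneObj

attribute [instance] addCommGroup module addCommGroupX moduleX

variable {σ : ∀ i, k →+* D i}

instance : Category (RankOneObj.{t} σ) where
  Hom A B := homs A.α B.α
  id A := ⟨LinearMap.id, isMor_id A.α⟩
  comp f g := ⟨g.1 ∘ₗ f.1, IsMor.comp g.2 f.2⟩

instance (A B : RankOneObj.{t} σ) : AddCommGroup (A ⟶ B) :=
  inferInstanceAs (AddCommGroup (homs A.α B.α))

/-- The linear map underlying a morphism. -/
def toLin {A B : RankOneObj.{t} σ} (f : A ⟶ B) : A.K →ₗ[k] B.K := Subtype.val f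

theorem isMor_toLin {A B : RankOneObj.{t} σ} (f : A ⟶ B) : IsMor A.α B.α (toLin f) := f.2

/-- The morphism with a given underlying linear map. -/
def ofLin {A B : RankOneObj.{t} σ} (f : A.K →ₗ[k] B.K) (hf : IsMor A.α B.α f) : A ⟶ B :=
  Subtype.mk f hf

theorem hom_ext {A B : RankOneObj.{t} σ} {f g : A ⟶ B} (h : toLin f = toLin g) : f = g :=
  Subtype.ext h

theorem toLin_comp {A B C : RankOneObj.{t} σ} (f : A ⟶ B) (g : B ⟶ C) :
    toLin (f ≫ g) = toLin g ∘ₗ toLin f := rfl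

theorem toLin_eq_zero {A B : RankOneObj.{t} σ} {f : A ⟶ B} : toLin f = 0 ↔ f = 0 :=
  ⟨fun h => hom_ext h, fun h => h ▸ rfl⟩

theorem toLin_add {A B : RankOneObj.{t} σ} (f g : A ⟶ B) :
    toLin (f + g) = toLin f + toLin g := rfl

instance : Preadditive (RankOneObj.{t} σ) where
  add_comp _ _ _ f f' g := hom_ext <| by
    simp only [toLin_comp, toLin_add, LinearMap.comp_add]
  comp_add _ _ _ f g g' := hom_ext <| by
    simp only [toLin_comp, toLin_add, LinearMap.add_comp]

theorem toLin_injective {A B : RankOneObj.{t} σ} {f : A ⟶ B} (hf : f ≠ 0) :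
    Function.Injective (toLin f) :=
  (isMor_toLin f).injective_of_ne_zero A.torsionFree A.rankOne B.torsionFree
    fun h => hf (toLin_eq_zero.1 h)

theorem exists_ne_zero (A : RankOneObj.{t} σ) : ∃ x : A.K, x ≠ 0 :=
  A.rankOne.imp fun _ h => h.1

instance : (Preadditive.nonzero (RankOneObj.{t} σ)).HasLeftCalculusOfFractions := by
  refine Preadditive.nonzero_hasLeftCalculusOfFractions (fun A h => ?_)
    (fun {A B C f g} hf hg h => ?_) (fun {A B C f g} hf hg => ?_)
  · obtain ⟨x, hx⟩ := A.exists_ne_zero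
    exact hx (LinearMap.congr_fun (toLin_eq_zero.2 h) x)
  · obtain ⟨x, hx⟩ := A.exists_ne_zero
    refine hx (toLin_injective hf (toLin_injective hg ?_))
    rw [map_zero, map_zero]
    exact LinearMap.congr_fun (toLin_eq_zero.2 h) x
  · obtain ⟨N, h1, h2, h3, h4⟩ := exists_quotient_prod_square A.torsionFree A.rankOne
      B.torsionFree B.rankOne C.torsionFree C.rankOne (isMor_toLin f) (isMor_toLin g)
      (fun h => hf (toLin_eq_zero.1 h)) (fun h => hg (toLin_eq_zero.1 h))
    let T : RankOneObj.{t} σ := ⟨_, _, quotient (prod B.α C.α) N, h1, h2⟩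
    exact ⟨T, ofLin _ ((isMor_mkQ _ N).comp (isMor_inl B.α C.α)),
      ofLin _ ((isMor_mkQ _ N).comp (isMor_inr B.α C.α)), hom_ext h3,
      fun h => h4 (toLin_eq_zero.2 h)⟩

end RankOneObj

/-- A ring acting faithfully from the right by endomorphisms of a torsion-free family of rank one
embeds into a division ring. -/
theorem exists_divisionRing_of_rankOne {σ : ∀ i, k →+* D i} {K : Type t} {X : ι → Type t}
    [AddCommGroup K] [Module k K] [∀ i, AddCommGroup (X i)] [∀ i, Module (D i) (X i)]
    {α : ∀ i, K →ₛₗ[σ i] X i} (h : TorsionFree α) (h1 : RankOne α) {R : Type*} [Ring R]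
    (ρ : R →+* (Module.End k K)ᵐᵒᵖ) (hρ : Function.Injective ρ)
    (hmor : ∀ r, IsMor α α (ρ r).unop) :
    ∃ (E : Type (max a b c (t + 1))) (_ : DivisionRing E) (f : R →+* E), Function.Injective f := by
  let A : RankOneObj.{t} σ := ⟨K, X, α, h, h1⟩
  obtain ⟨E, _, f, hf⟩ := Preadditive.exists_divisionRing_of_hasLeftCalculusOfFractions A
  let g : R →+* (CategoryTheory.End A)ᵐᵒᵖ :=
    { toFun r := .op (RankOneObj.ofLin (ρ r).unop (hmor r))
      map_one' := MulOpposite.unop_injective (RankOneObj.hom_ext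
        (congrArg MulOpposite.unop (map_one ρ)))
      map_mul' r s := MulOpposite.unop_injective (RankOneObj.hom_ext
        (congrArg MulOpposite.unop (map_mul ρ r s)))
      map_zero' := MulOpposite.unop_injective (RankOneObj.hom_ext
        (congrArg MulOpposite.unop (map_zero ρ)))
      map_add' r s := MulOpposite.unop_injective (RankOneObj.hom_ext
        (congrArg MulOpposite.unop (map_add ρ r s))) }
  refine ⟨Eᵐᵒᵖ, inferInstance, f.op.comp g, ?_⟩
  intro r s hrs
  have h2 := hf (MulOpposite.op_injective hrs)
  exact hρ (MulOpposite.unop_injective (congrArg RankOneObj.toLin h2))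

end SemilinearFamily

namespace Monoid.CoprodI.Word

variable {ι : Type*} {M : ι → Type*} [∀ i, Monoid (M i)] [DecidableEq ι]
  [∀ i, DecidableEq (M i)]

theorem equiv_of_mul {i : ι} (m : M i) (g : CoprodI M) :
    equiv (of m * g) = of m • equiv g :=
  show (of m * g) • (empty : Word M) = of m • g • (empty : Word M) from mul_smul _ _ _

theorem equivPair_equiv_of_mul {i : ι} (m : M i) (g : CoprodI M) :
    equivPair i (equiv (of m * g)) =
      { equivPair i (equiv g) with head := m * (equivPair i (equiv g)).head } := by
  rw [equiv_of_mul, equivPair_smul_same]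

theorem of_head_mul_prod_tail (i : ι) (g : CoprodI M) :
    of (equivPair i (equiv g)).head * (equivPair i (equiv g)).tail.prod = g := by
  rw [← prod_smul, equivPair_head_smul_equivPair_tail]
  exact equiv.symm_apply_apply g

theorem eq_of_equivPair_tail_eq {i : ι} {g e : CoprodI M}
    (h : (equivPair i (equiv g)).tail = equiv e)
    (hl : (equiv g).toList.length ≤ (equiv e).toList.length) : g = e := by
  apply equiv.injective
  have hg := (equivPair i).symm_apply_apply (equiv g)
  rw [equivPair_symm, rcons] at hg
  split_ifs at hg with h1
  · rw [← hg, h]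
  · rw [← hg, ← h] at hl
    simp [cons] at hl

end Monoid.CoprodI.Word

namespace SemilinearFamily

open Module Monoid MonoidAlgebra

variable {k : Type*} {ι : Type*} [DivisionRing k] {G : ι → Type*} [∀ i, Group (G i)]
  {D : ι → Type*} [∀ i, DivisionRing (D i)] [DecidableEq ι] [∀ i, DecidableEq (G i)]
  (f : ∀ i, MonoidAlgebra k (G i) →+* D i)

/-- The tail and the head of a group element with respect to a factor. -/
def tailHead (i : ι) (g : CoprodI G) : CoprodI.Word G × G i :=
  ((CoprodI.Word.equivPair i (CoprodI.Word.equiv g)).tail,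
    (CoprodI.Word.equivPair i (CoprodI.Word.equiv g)).head)

theorem tailHead_injective (i : ι) : Function.Injective (tailHead (G := G) i) := by
  intro g h hgh
  rw [← CoprodI.Word.of_head_mul_prod_tail i g, ← CoprodI.Word.of_head_mul_prod_tail i h]
  rw [tailHead, tailHead, Prod.mk.injEq] at hgh
  rw [hgh.1, hgh.2]

/-- The additive map underlying `coprodFamily`: view the group algebra of the free product as a
free left module over the group algebra of a factor and extend scalars along `f i`. -/
noncomputable def coprodAddHom (i : ι) :
    MonoidAlgebra k (CoprodI G) →+ (CoprodI.Word G →₀ D i) :=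
  (Finsupp.mapRange.addMonoidHom
    ((f i).toAddMonoidHom.comp (coeffAddEquiv (R := k) (M := G i)).symm.toAddMonoidHom)).comp <|
  (Finsupp.curryAddEquiv (M := k)).toAddMonoidHom.comp <|
  (Finsupp.mapDomain.addMonoidHom (tailHead i)).comp coeffAddEquiv.toAddMonoidHom

theorem coprodAddHom_injective (i : ι) (hf : Function.Injective (f i)) :
    Function.Injective (coprodAddHom f i) :=
  (Finsupp.mapRange_injective _ (by simp) (hf.comp coeffAddEquiv.symm.injective)).comp <|
    Finsupp.curryAddEquiv.injective.comp <|
      (Finsupp.mapDomain_injective (tailHead_injective i)).comp coeffAddEquiv.injective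

theorem coprodAddHom_single (i : ι) (g : CoprodI G) (c : k) :
    coprodAddHom f i (single g c) =
      Finsupp.single (tailHead i g).1 (f i (single (tailHead i g).2 c)) := by
  simp [coprodAddHom]

theorem coprodAddHom_of_mul (i : ι) (h : G i) (c : k) (y : MonoidAlgebra k (CoprodI G)) :
    coprodAddHom f i (single (CoprodI.of h) c * y) = f i (single h c) • coprodAddHom f i y := by
  induction y using MonoidAlgebra.induction_linear with
  | zero => simp
  | add x y hx hy => rw [mul_add, map_add, hx, hy, map_add, smul_add]
  | single g d =>
    rw [single_mul_single, coprodAddHom_single, coprodAddHom_single, Finsupp.smul_single,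
      smul_eq_mul, ← map_mul, single_mul_single]
    simp only [tailHead, CoprodI.Word.equivPair_equiv_of_mul]

/-- The family of semilinear maps attached to ring homomorphisms from the group algebras of the
factors of a free product to division rings. -/
noncomputable def coprodFamily (i : ι) : MonoidAlgebra k (CoprodI G)
    →ₛₗ[(f i).comp singleOneRingHom] (CoprodI.Word G →₀ D i) where
  __ := coprodAddHom f i
  map_smul' c y := by
    have h := coprodAddHom_of_mul f i 1 c y
    rw [map_one] at h
    have : c • y = single 1 c * y := by ext; simp
    rw [this]
    exact h

theorem coprodFamily_apply (i : ι) (x : MonoidAlgebra k (CoprodI G)) :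
    coprodFamily f i x = coprodAddHom f i x := rfl

theorem isMor_mulRight (r : MonoidAlgebra k (CoprodI G)) :
    IsMor (coprodFamily f) (coprodFamily f) (LinearMap.mulRight k r) := fun i => by
  refine ⟨Finsupp.linearCombination (D i) fun t => coprodFamily f i (single t.prod 1 * r),
    fun x => ?_⟩
  induction x using MonoidAlgebra.induction_linear with
  | zero => simp
  | add x y hx hy => rw [map_add, map_add, hx, hy, map_add, map_add]
  | single g c =>
    rw [coprodFamily_apply, coprodAddHom_single, Finsupp.linearCombination_single,
      coprodFamily_apply, ← coprodAddHom_of_mul, ← mul_assoc, single_mul_single, mul_one]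
    simp only [tailHead, CoprodI.Word.of_head_mul_prod_tail]
    rfl

theorem coprodFamily_apply_apply_of_length_le (i : ι) (x : MonoidAlgebra k (CoprodI G))
    (e : CoprodI G) (he : (CoprodI.Word.equiv e).fstIdx ≠ some i)
    (hx : ∀ g, x.coeff g ≠ 0 →
      (CoprodI.Word.equiv g).toList.length ≤ (CoprodI.Word.equiv e).toList.length) :
    coprodFamily f i x (CoprodI.Word.equiv e) = f i (single 1 (x.coeff e)) := by
  have hte : tailHead i e = (CoprodI.Word.equiv e, 1) := by
    rw [tailHead, CoprodI.Word.equivPair_eq_of_fstIdx_ne he]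
  rw [coprodFamily_apply]
  conv_lhs => rw [← sum_coeff_single x, Finsupp.sum, map_sum, Finsupp.finsetSum_apply]
  rw [Finset.sum_eq_single e]
  · simp [coprodAddHom_single, hte]
  · intro g hg hge
    rw [coprodAddHom_single, Finsupp.single_eq_of_ne']
    exact fun h => hge (CoprodI.Word.eq_of_equivPair_tail_eq h (hx g (by simpa using hg)))
  · intro h
    have : x.coeff e = 0 := by simpa using h
    simp [this]

theorem exists_maximal_length (B : Submodule k (MonoidAlgebra k (CoprodI G)))
    [FiniteDimensional k B] (hB : B ≠ ⊥) :
    ∃ e : CoprodI G, (∃ x ∈ B, x.coeff e ≠ 0) ∧ ∀ x ∈ B, ∀ g, x.coeff g ≠ 0 →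
      (CoprodI.Word.equiv g).toList.length ≤ (CoprodI.Word.equiv e).toList.length := by
  obtain ⟨s, rfl⟩ := (Submodule.fg_iff_finiteDimensional B).2 inferInstance
  set S : Set (CoprodI G) := {g | ∃ x ∈ Submodule.span k (s : Set (MonoidAlgebra k (CoprodI G))),
    x.coeff g ≠ 0} with hS
  have hfin : S.Finite := by
    refine (s.finite_toSet.biUnion fun y _ => y.coeff.support.finite_toSet).subset ?_
    rintro g ⟨x, hx, hxg⟩
    by_contra hg
    simp only [Set.mem_iUnion, Finset.mem_coe, Finsupp.mem_support_iff, not_exists, not_not] at hg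
    have : Submodule.span k (s : Set (MonoidAlgebra k (CoprodI G))) ≤
        LinearMap.ker (Finsupp.lapply g ∘ₗ (coeffLinearEquiv k).toLinearMap) :=
      Submodule.span_le.2 fun y hy => hg y hy
    exact hxg (this hx)
  have hne : S.Nonempty := by
    obtain ⟨x, hx, hx0⟩ := (Submodule.ne_bot_iff _).1 hB
    by_contra! h
    refine hx0 (coeff_injective (Finsupp.ext fun g => ?_))
    by_contra hg
    exact (h ▸ (⟨x, hx, hg⟩ : g ∈ S) : g ∈ (∅ : Set _))
  obtain ⟨e, he, hmax⟩ := Set.exists_max_image S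
    (fun g => (CoprodI.Word.equiv g).toList.length) hfin hne
  exact ⟨e, he, fun x hx g hg => hmax g ⟨x, hx, hg⟩⟩

theorem torsionFree_coprodFamily (hf : ∀ i, Function.Injective (f i)) :
    TorsionFree (coprodFamily f) := by
  intro F B hfd hB
  induction hn : finrank k B using Nat.strong_induction_on generalizing B with
  | _ n ih =>
  obtain ⟨e, ⟨x, hxB, hxe⟩, hmax⟩ := exists_maximal_length B hB
  let c : MonoidAlgebra k (CoprodI G) →ₗ[k] k :=
    Finsupp.lapply e ∘ₗ (coeffLinearEquiv k).toLinearMap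
  have hc (y) : c y = y.coeff e := rfl
  obtain ⟨B', hB'⟩ : ∃ B', B' = B ⊓ LinearMap.ker c := ⟨_, rfl⟩
  have hle : B' ≤ B := hB' ▸ inf_le_left
  have hmem {y} (hy : y ∈ B') : y.coeff e = 0 := (hB' ▸ hy : y ∈ B ⊓ LinearMap.ker c).2
  have : FiniteDimensional k B' := Submodule.finiteDimensional_of_le hle
  have hfdX (i : ι) : FiniteDimensional (D i) (hull (coprodFamily f) i B) :=
    finiteDimensional_hull (coprodFamily f) i B
  have hdim : finrank k B' + 1 = finrank k B := by
    have h1 := Submodule.finrank_map_add_finrank_inf_ker c B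
    have h2 : B.map c = ⊤ := Submodule.eq_top_iff'.2 fun d =>
      ⟨(d * (x.coeff e)⁻¹) • x, B.smul_mem _ hxB, by
        rw [map_smul, hc, smul_eq_mul, inv_mul_cancel_right₀ hxe]⟩
    rw [← hB', h2, finrank_top, finrank_self] at h1
    omega
  have hexc (i : ι) (hi : (CoprodI.Word.equiv e).fstIdx ≠ some i) :
      finrank (D i) (hull (coprodFamily f) i B') + 1 ≤
        finrank (D i) (hull (coprodFamily f) i B) := by
    refine Submodule.finrank_lt_finrank_of_lt (lt_of_le_of_ne (hull_mono _ i hle) fun h => ?_)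
    have hker : hull (coprodFamily f) i B' ≤
        LinearMap.ker (Finsupp.lapply (R := D i) (M := D i) (CoprodI.Word.equiv e)) := by
      refine (hull_le_iff _).2 fun y hy => ?_
      rw [LinearMap.mem_ker, Finsupp.lapply_apply,
        coprodFamily_apply_apply_of_length_le f i y e hi (hmax y (hle hy)), hmem hy,
        single_zero, map_zero]
    have h1 := hker (h ▸ mem_hull (coprodFamily f) hxB)
    rw [LinearMap.mem_ker, Finsupp.lapply_apply,
      coprodFamily_apply_apply_of_length_le f i x e hi (hmax x hxB),
      map_eq_zero_iff _ (hf i), single_eq_zero] at h1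
    exact hxe h1
  by_cases hbot : B' = ⊥
  · have hB1 : finrank k B = 1 := by rw [← hdim, hbot, finrank_bot]
    have : 0 ≤ ∑ i ∈ F, ((finrank (D i) (hull (coprodFamily f) i B) : ℤ) - finrank k B) := by
      refine Finset.sum_nonneg fun i _ => ?_
      have hne : hull (coprodFamily f) i B ≠ ⊥ := by
        refine (Submodule.ne_bot_iff _).2 ⟨_, mem_hull _ hxB, fun h => hxe ?_⟩
        rw [coprodFamily_apply, map_eq_zero_iff _ (coprodAddHom_injective f i (hf i))] at h
        simp [h]
      have := Submodule.one_le_finrank_iff.2 hne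
      omega
    rw [predim, hB1] at *
    omega
  · have h1 := ih _ (by omega) B' inferInstance hbot rfl
    have h2 : ∑ i ∈ F, ((finrank (D i) (hull (coprodFamily f) i B') : ℤ) - finrank k B') - 1 ≤
        ∑ i ∈ F, ((finrank (D i) (hull (coprodFamily f) i B) : ℤ) - finrank k B) := by
      have h3 (i : ι) := Submodule.finrank_mono (hull_mono (coprodFamily f) i hle)
      have h4 : ∑ i ∈ F, ((finrank (D i) (hull (coprodFamily f) i B') : ℤ) - finrank k B') ≤
          ∑ i ∈ F, (((finrank (D i) (hull (coprodFamily f) i B) : ℤ) - finrank k B) +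
            if (CoprodI.Word.equiv e).fstIdx = some i then 1 else 0) := by
        refine Finset.sum_le_sum fun i _ => ?_
        split_ifs with hi
        · have := h3 i
          omega
        · have := hexc i hi
          omega
      have h5 : ∑ i ∈ F, (if (CoprodI.Word.equiv e).fstIdx = some i then (1 : ℤ) else 0) ≤ 1 := by
        rw [Finset.sum_boole]
        norm_cast
        refine Finset.card_le_one.2 fun i hi j hj => ?_
        rw [Finset.mem_filter] at hi hj
        exact Option.some_injective _ (hi.2.symm.trans hj.2)
      rw [Finset.sum_add_distrib] at h4
      linarith
    rw [predim] at *
    omega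

theorem isAlgebraicOver_coprodFamily_of_mul (i : ι) (m : G i) (x : MonoidAlgebra k (CoprodI G)) :
    IsAlgebraicOver (coprodFamily f) x (single (CoprodI.of m) 1 * x) := by
  have : FiniteDimensional k (Submodule.span k {x, single (CoprodI.of m) 1 * x}) :=
    FiniteDimensional.span_of_finite k (by simp)
  refine ⟨{i}, Submodule.span k {x, single (CoprodI.of m) 1 * x}, this,
    Submodule.subset_span (by simp), Submodule.subset_span (by simp), ?_⟩
  have h1 : hull (coprodFamily f) i (Submodule.span k {x, single (CoprodI.of m) 1 * x}) ≤
      Submodule.span (D i) {coprodFamily f i x} := by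
    rw [hull_span, Submodule.span_le]
    rintro _ ⟨y, rfl | rfl, rfl⟩
    · exact Submodule.mem_span_singleton_self _
    · exact Submodule.mem_span_singleton.2 ⟨_, (coprodAddHom_of_mul f i m 1 x).symm⟩
  have h2 := (Submodule.finrank_mono h1).trans (finrank_span_le_card _)
  simp only [Set.toFinset_singleton, Finset.card_singleton] at h2
  rw [predim, Finset.sum_singleton]
  omega

theorem rankOne_coprodFamily (hf : ∀ i, Function.Injective (f i)) :
    RankOne (coprodFamily f) := by
  have h := torsionFree_coprodFamily f hf
  have h1 : (1 : MonoidAlgebra k (CoprodI G)) ≠ 0 := one_ne_zero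
  have hg (g : CoprodI G) : single g 1 ∈ h.closure h1 := by
    induction g using CoprodI.induction_left with
    | one => exact self_mem_closure h h1
    | mul m x hx =>
      have := h.isAlgebraicOver_trans (by simp) hx (isAlgebraicOver_coprodFamily_of_mul f _ m _)
      rwa [single_mul_single, one_mul] at this
  refine ⟨1, h1, fun v => (h.mem_closure h1).1 ?_⟩
  induction v using MonoidAlgebra.induction_on with
  | of g => exact hg g
  | add x y hx hy => exact add_mem hx hy
  | smul c x hx => exact Submodule.smul_mem _ c hx

end SemilinearFamily

open Cardinal in
theorem Subfield.small_closure {E : Type*} [DivisionRing E] (s : Set E) [Small.{t} s] :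
    Small.{t} (Subfield.closure s) := by
  obtain ⟨e⟩ : Nonempty (Subfield.closure s ↪ s ⊕ ℕ) := by
    rw [← lift_mk_le', mk_sum, lift_id', lift_id']
    simpa using (Subfield.cardinalMk_closure_le_max s).trans
      (max_le (self_le_add_right _ _) (self_le_add_left _ _))
  exact small_of_injective e.injective

/-- A ring that embeds into a division ring embeds into one of its own universe. -/
theorem exists_divisionRing_small {R : Type t} [Ring R] {E : Type*} [DivisionRing E]
    (f : R →+* E) (hf : Function.Injective f) :
    ∃ (D : Type t) (_ : DivisionRing D) (g : R →+* D), Function.Injective g := by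
  have : Small.{t} (Subfield.closure (Set.range f)) := Subfield.small_closure _
  let h : R →+* Subfield.closure (Set.range f) :=
    f.codRestrict _ fun r => Subfield.subset_closure (Set.mem_range_self r)
  refine ⟨Shrink.{t} (Subfield.closure (Set.range f)), inferInstance,
    (Shrink.ringEquiv _).symm.toRingHom.comp h, (Shrink.ringEquiv _).symm.injective.comp ?_⟩
  exact fun a b hab => hf (congrArg Subtype.val hab)

/-- Let `k` be a division ring and `(G i)_{i ∈ ι}` a family of groups with free product
`G = ∗_i G i` (the coproduct in the category of groups, `Monoid.CoprodI`).  If each group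
algebra `k[G i]` embeds into a division ring, then so does `kG`. -/
theorem monoidAlgebra_coprodI_embeds_divisionRing
    {k : Type u} [DivisionRing k] {ι : Type v} (G : ι → Type w)
    [∀ i, Group (G i)]
    (hD : ∀ i, ∃ (Di : Type (max u w)) (_ : DivisionRing Di)
      (fi : MonoidAlgebra k (G i) →+* Di), Function.Injective fi) :
    ∃ (D : Type (max u v w)) (_ : DivisionRing D)
      (f : MonoidAlgebra k (Monoid.CoprodI G) →+* D),
      Function.Injective f := by
  classical
  choose D _ f hf using hD
  let ρ : MonoidAlgebra k (Monoid.CoprodI G) →+*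
      (Module.End k (MonoidAlgebra k (Monoid.CoprodI G)))ᵐᵒᵖ :=
    { toFun r := .op (LinearMap.mulRight k r)
      map_one' := MulOpposite.unop_injective (LinearMap.ext mul_one)
      map_mul' r s := MulOpposite.unop_injective (LinearMap.ext fun x => (mul_assoc x r s).symm)
      map_zero' := by simp
      map_add' r s := MulOpposite.unop_injective (LinearMap.ext fun x => mul_add x r s) }
  have hρ : Function.Injective ρ := fun r s hrs => by
    simpa [ρ] using LinearMap.congr_fun (MulOpposite.op_injective hrs) 1
  obtain ⟨E, _, g, hg⟩ := SemilinearFamily.exists_divisionRing_of_rankOne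
    (SemilinearFamily.torsionFree_coprodFamily f hf) (SemilinearFamily.rankOne_coprodFamily f hf)
    ρ hρ fun r => SemilinearFamily.isMor_mulRight f r
  exact exists_divisionRing_small g hg
end

section
/- Let k be a division ring and let G be a group that is the union of a directed family (G_i)_{i∈I} of subgroups (directed means: for all i, j ∈ I there is l ∈ I with G_i ∪ G_j ⊆ G_l). If for every i ∈ I the group algebra kG_i admits a Hughes-free embedding into a division ring, then G is locally indicable and kG admits a Hughes-free embedding into a division ring. -/
/-- A subring `S` of a ring `R` is a *division subring* if every nonzero element of `S`
has a two-sided inverse lying in `S`. -/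
def IsDivisionSubring {R : Type*} [Ring R] (S : Subring R) : Prop :=
  ∀ x ∈ S, x ≠ 0 → ∃ y ∈ S, x * y = 1 ∧ y * x = 1

/-- The *division closure* of a subset `s` of a ring `R`: the smallest division subring
of `R` containing `s` (realized as the infimum of all division subrings containing `s`). -/
def divisionClosure {R : Type*} [Ring R] (s : Set R) : Subring R :=
  sInf {S : Subring R | IsDivisionSubring S ∧ s ⊆ S}

lemma subset_divisionClosure {R : Type*} [Ring R] (s : Set R) :
    s ⊆ (divisionClosure s : Set R) := fun _x hx =>
  Subring.mem_sInf.2 fun _S hS => hS.2 hx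

/-- Integer powers of an element of a ring, using `Ring.inverse` for negative exponents.
When the ambient ring is a division ring this agrees with the usual `zpow`. -/
noncomputable def ringZPow {R : Type*} [Ring R] (x : R) (i : ℤ) : R :=
  if 0 ≤ i then x ^ i.toNat else (Ring.inverse x) ^ (-i).toNat

/-- A group is *locally indicable* if every nontrivial finitely generated subgroup
admits a surjective homomorphism onto `ℤ`. -/
def LocallyIndicable (G : Type*) [Group G] : Prop :=
  ∀ H : Subgroup G, H ≠ ⊥ → H.FG →
    ∃ f : H →* Multiplicative ℤ, Function.Surjective f

/-- `φ : kG →+* D` is a *Hughes-free embedding* if it is injective, the division closure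
of its image is all of `D`, and whenever `H ≤ G` is finitely generated, `K ⊴ H` and
`t ∈ H` are such that `H/K` is infinite cyclic generated by `tK`, the integer powers of
`φ t` are left linearly independent over the division closure of `φ (kK)` in `D`. -/
def IsHughesFreeEmbedding {k : Type*} [DivisionRing k] {G : Type*} [Group G]
    {D : Type*} [Ring D] (φ : MonoidAlgebra k G →+* D) : Prop :=
  Function.Injective φ ∧
  divisionClosure (Set.range φ) = ⊤ ∧
  ∀ (H : Subgroup G), H.FG → ∀ (K : Subgroup H) (t : H),
    (∃ f : H →* Multiplicative ℤ,
        Function.Surjective f ∧ f.ker = K ∧ f t = Multiplicative.ofAdd 1) →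
    ∀ c : ℤ →₀ D,
      (∀ i : ℤ, c i ∈ divisionClosure
          (Set.range (φ.comp (MonoidAlgebra.mapDomainRingHom k (H.subtype.comp K.subtype))))) →
      (c.sum fun i a => a * ringZPow (φ (MonoidAlgebra.of k G (H.subtype t))) i) = 0 →
      c = 0

/-- A topological space is a *3-manifold* if it is nonempty, connected, Hausdorff,
second countable, and every point has an open neighbourhood homeomorphic to `ℝ³`. -/
def Is3Manifold (M : Type*) [TopologicalSpace M] : Prop :=
  Nonempty M ∧ ConnectedSpace M ∧ T2Space M ∧ SecondCountableTopology M ∧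
    ∀ x : M, ∃ U : Set M, IsOpen U ∧ x ∈ U ∧ Nonempty (U ≃ₜ (Fin 3 → ℝ))

open Filter

/-- The third clause of `IsHughesFreeEmbedding`. -/
def HughesIndependent {k : Type*} [DivisionRing k] {G : Type*} [Group G]
    {D : Type*} [Ring D] (φ : MonoidAlgebra k G →+* D) : Prop :=
  ∀ (H : Subgroup G), H.FG → ∀ (K : Subgroup H) (t : H),
    (∃ f : H →* Multiplicative ℤ,
        Function.Surjective f ∧ f.ker = K ∧ f t = Multiplicative.ofAdd 1) →
    ∀ c : ℤ →₀ D,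
      (∀ i : ℤ, c i ∈ divisionClosure
          (Set.range (φ.comp (MonoidAlgebra.mapDomainRingHom k (H.subtype.comp K.subtype))))) →
      (c.sum fun i a => a * ringZPow (φ (MonoidAlgebra.of k G (H.subtype t))) i) = 0 →
      c = 0

lemma ringZPow_eq_zpow {D : Type*} [DivisionRing D] (x : D) (i : ℤ) : ringZPow x i = x ^ i := by
  unfold ringZPow
  split_ifs with h
  · lift i to ℕ using h
    simp
  · obtain ⟨n, rfl⟩ : ∃ n : ℕ, i = -n := ⟨(-i).toNat, by lia⟩
    simp

section DivisionClosure

variable {D E : Type*} [DivisionRing D] [DivisionRing E]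

lemma isDivisionSubring_iff_inv_mem {S : Subring D} :
    IsDivisionSubring S ↔ ∀ x ∈ S, x⁻¹ ∈ S := by
  refine ⟨fun h x hx => ?_, fun h x hx hx0 =>
    ⟨x⁻¹, h x hx, mul_inv_cancel₀ hx0, inv_mul_cancel₀ hx0⟩⟩
  obtain rfl | hx0 := eq_or_ne x 0
  · simp
  · obtain ⟨y, hy, hxy, -⟩ := h x hx hx0
    rwa [inv_eq_of_mul_eq_one_right hxy]

lemma isDivisionSubring_divisionClosure (s : Set D) : IsDivisionSubring (divisionClosure s) :=
  isDivisionSubring_iff_inv_mem.2 fun x hx => Subring.mem_sInf.2 fun S hS =>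
    isDivisionSubring_iff_inv_mem.1 hS.1 x (Subring.mem_sInf.1 hx S hS)

lemma divisionClosure_le {R : Type*} [Ring R] {s : Set R} {S : Subring R}
    (hS : IsDivisionSubring S) (h : s ⊆ S) : divisionClosure s ≤ S :=
  sInf_le ⟨hS, h⟩

lemma IsDivisionSubring.comap {S : Subring E} (hS : IsDivisionSubring S) (f : D →+* E) :
    IsDivisionSubring (S.comap f) :=
  isDivisionSubring_iff_inv_mem.2 fun x hx => by
    simpa using isDivisionSubring_iff_inv_mem.1 hS _ hx

lemma IsDivisionSubring.map {S : Subring D} (hS : IsDivisionSubring S) (f : D →+* E) :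
    IsDivisionSubring (S.map f) :=
  isDivisionSubring_iff_inv_mem.2 <| by
    rintro _ ⟨x, hx, rfl⟩
    exact ⟨x⁻¹, isDivisionSubring_iff_inv_mem.1 hS x hx, map_inv₀ f x⟩

/-- A division subring of a division ring is a division ring. -/
noncomputable abbrev IsDivisionSubring.divisionRing {S : Subring D} (hS : IsDivisionSubring S) :
    DivisionRing S :=
  DivisionRing.ofIsUnitOrEqZero fun a => by
    refine or_iff_not_imp_right.2 fun ha => ?_
    obtain ⟨y, hy, h1, h2⟩ := hS a a.2 (by simpa using ha)
    exact ⟨⟨a, ⟨y, hy⟩, Subtype.ext h1, Subtype.ext h2⟩, rfl⟩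

end DivisionClosure

/-- An injective Hughes-independent homomorphism into a division ring becomes a Hughes-free
embedding after restricting the codomain to the division closure of the image. -/
lemma HughesIndependent.exists_isHughesFreeEmbedding {k : Type*} [DivisionRing k]
    {G : Type*} [Group G] {E : Type u} [DivisionRing E] {φ : MonoidAlgebra k G →+* E}
    (hφ : HughesIndependent φ) (hinj : Function.Injective φ) :
    ∃ (D : Type u) (_ : DivisionRing D) (ψ : MonoidAlgebra k G →+* D),
      IsHughesFreeEmbedding ψ := by
  let S := divisionClosure (Set.range φ)
  let _ : DivisionRing S := (isDivisionSubring_divisionClosure (Set.range φ)).divisionRing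
  let ψ : MonoidAlgebra k G →+* S :=
    φ.codRestrict S fun x => subset_divisionClosure _ ⟨x, rfl⟩
  have hψ (x) : S.subtype (ψ x) = φ x := rfl
  refine ⟨S, inferInstance, ψ, fun x y h => hinj (congrArg S.subtype h), ?_, ?_⟩
  · refine eq_top_iff.2 fun x _ => ?_
    obtain ⟨y, hy, hyx⟩ := divisionClosure_le
      ((isDivisionSubring_divisionClosure (Set.range ψ)).map S.subtype)
      (by rintro _ ⟨z, rfl⟩; exact ⟨ψ z, subset_divisionClosure _ ⟨z, rfl⟩, rfl⟩) x.2
    rwa [← Subtype.ext hyx]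
  · intro H hH K t hf c hc hsum
    have h := hφ H hH K t hf (c.mapRange S.subtype (map_zero _)) (fun i => ?_) ?_
    · refine Finsupp.mapRange_injective S.subtype (map_zero _) S.subtype_injective ?_
      rw [h, Finsupp.mapRange_zero]
    · refine divisionClosure_le ((isDivisionSubring_divisionClosure _).comap S.subtype) ?_ (hc i)
      rintro _ ⟨z, rfl⟩
      exact subset_divisionClosure _ ⟨z, rfl⟩
    · rw [Finsupp.sum_mapRange_index (by simp)]
      have := congrArg S.subtype hsum
      simpa only [map_zero, map_finsuppSum, map_mul, ringZPow_eq_zpow, map_zpow₀, hψ] using this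

section Ultraproduct

variable {J : Type*} (U : Ultrafilter J) (D : J → Type*) [∀ j, DivisionRing (D j)]

/-- The ideal of families that vanish on a set of the ultrafilter. -/
def ultraIdeal : Ideal (∀ j, D j) where
  carrier := {x | ∀ᶠ j in U, x j = 0}
  add_mem' hx hy := by filter_upwards [hx, hy] with j h1 h2; simp [h1, h2]
  zero_mem' := by simp
  smul_mem' c x hx := by filter_upwards [hx] with j h; simp [h]

instance : (ultraIdeal U D).IsTwoSided :=
  ⟨fun {x} b hx => by
    change ∀ᶠ j in U, x j * b j = 0
    filter_upwards [hx] with j h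
    simp [h]⟩

/-- The ultraproduct of a family of division rings. -/
abbrev Ultraproduct : Type _ := (∀ j, D j) ⧸ ultraIdeal U D

variable {D}

/-- The class of a family in the ultraproduct. -/
abbrev Ultraproduct.mk : (∀ j, D j) →+* Ultraproduct U D := Ideal.Quotient.mk (ultraIdeal U D)

variable {U}

lemma Ultraproduct.mk_eq_zero {x : ∀ j, D j} : mk U x = 0 ↔ ∀ᶠ j in U, x j = 0 :=
  Ideal.Quotient.eq_zero_iff_mem

lemma Ultraproduct.mk_eq_mk {x y : ∀ j, D j} : mk U x = mk U y ↔ ∀ᶠ j in U, x j = y j := by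
  rw [← sub_eq_zero, ← map_sub, mk_eq_zero]
  simp [sub_eq_zero]

lemma Ultraproduct.mk_mul_mk_inv {x : ∀ j, D j} (hx : mk U x ≠ 0) :
    mk U x * mk U (fun j => (x j)⁻¹) = 1 ∧ mk U (fun j => (x j)⁻¹) * mk U x = 1 := by
  rw [Ne, mk_eq_zero, ← Ultrafilter.eventually_not] at hx
  simp only [← map_mul, ← map_one (mk U), mk_eq_mk]
  constructor <;> filter_upwards [hx] with j hj <;> simp [hj]

noncomputable instance : DivisionRing (Ultraproduct U D) :=
  haveI : Nontrivial (Ultraproduct U D) := by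
    refine ⟨1, 0, ?_⟩
    rw [← map_one (Ultraproduct.mk U), Ne, Ultraproduct.mk_eq_zero]
    simpa using NeBot.ne inferInstance
  DivisionRing.ofIsUnitOrEqZero fun a => by
    refine or_iff_not_imp_right.2 fun ha => ?_
    obtain ⟨x, rfl⟩ := Ideal.Quotient.mk_surjective a
    obtain ⟨h1, h2⟩ := Ultraproduct.mk_mul_mk_inv ha
    exact ⟨⟨_, _, h1, h2⟩, rfl⟩

lemma Ultraproduct.mk_inv (x : ∀ j, D j) : mk U (fun j => (x j)⁻¹) = (mk U x)⁻¹ := by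
  by_cases hx : mk U x = 0
  · rw [hx, inv_zero, mk_eq_zero]
    filter_upwards [mk_eq_zero.1 hx] with j hj
    simp [hj]
  · exact eq_inv_of_mul_eq_one_right (mk_mul_mk_inv hx).1

lemma Ultraproduct.mk_zpow (x : ∀ j, D j) (i : ℤ) :
    mk U (fun j => x j ^ i) = mk U x ^ i := by
  obtain ⟨n, rfl | rfl⟩ := i.eq_nat_or_neg
  · simp only [zpow_natCast, ← map_pow]
    rfl
  · simp only [zpow_neg, zpow_natCast, mk_inv, ← map_pow]
    rfl

variable (U) in
/-- The ultraproduct of a family of subrings. -/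
def Ultraproduct.subring (C : ∀ j, Subring (D j)) : Subring (Ultraproduct U D) where
  carrier := {y | ∃ x : ∀ j, D j, (∀ j, x j ∈ C j) ∧ mk U x = y}
  zero_mem' := ⟨0, fun j => zero_mem _, map_zero _⟩
  one_mem' := ⟨1, fun j => one_mem _, map_one _⟩
  add_mem' := by
    rintro _ _ ⟨x, hx, rfl⟩ ⟨y, hy, rfl⟩
    exact ⟨x + y, fun j => add_mem (hx j) (hy j), map_add _ _ _⟩
  mul_mem' := by
    rintro _ _ ⟨x, hx, rfl⟩ ⟨y, hy, rfl⟩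
    exact ⟨x * y, fun j => mul_mem (hx j) (hy j), map_mul _ _ _⟩
  neg_mem' := by
    rintro _ ⟨x, hx, rfl⟩
    exact ⟨-x, fun j => neg_mem (hx j), map_neg _ _⟩

lemma Ultraproduct.isDivisionSubring_subring {C : ∀ j, Subring (D j)}
    (hC : ∀ j, IsDivisionSubring (C j)) : IsDivisionSubring (subring U C) :=
  isDivisionSubring_iff_inv_mem.2 <| by
    rintro _ ⟨x, hx, rfl⟩
    exact ⟨fun j => (x j)⁻¹, fun j => isDivisionSubring_iff_inv_mem.1 (hC j) _ (hx j), mk_inv x⟩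

lemma Ultraproduct.mk_mem_subring {C : ∀ j, Subring (D j)} {x : ∀ j, D j}
    (hx : ∀ᶠ j in U, x j ∈ C j) : mk U x ∈ subring U C := by
  classical
  refine ⟨fun j => if x j ∈ C j then x j else 0, fun j => ?_, ?_⟩
  · dsimp only
    split_ifs with h
    exacts [h, zero_mem _]
  · refine mk_eq_mk.2 ?_
    filter_upwards [hx] with j hj
    simp [hj]

end Ultraproduct

section UnionOfSubgroups

variable {G : Type*} [Group G] {J : Type*} {l : Filter J} {L : J → Subgroup G}

lemma Subgroup.FG.eventually_le (hL : ∀ g, ∀ᶠ j in l, g ∈ L j) {H : Subgroup G} (hH : H.FG) :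
    ∀ᶠ j in l, H ≤ L j := by
  obtain ⟨s, rfl⟩ := hH
  filter_upwards [(eventually_all_finset s).2 fun g _ => hL g] with j hj
  exact (Subgroup.closure_le _).2 hj

lemma Subgroup.FG.subgroupOf {H K : Subgroup G} (hH : H.FG) (h : H ≤ K) :
    (H.subgroupOf K).FG := by
  rw [← Group.fg_iff_subgroup_fg] at hH ⊢
  exact Group.fg_of_surjective (f := (Subgroup.subgroupOfEquivOfLe h).symm.toMonoidHom)
    (Subgroup.subgroupOfEquivOfLe h).symm.surjective

lemma LocallyIndicable.of_eventually_mem [l.NeBot] (hL : ∀ g, ∀ᶠ j in l, g ∈ L j)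
    (hli : ∀ j, LocallyIndicable (L j)) : LocallyIndicable G := by
  intro H hH hfg
  obtain ⟨j, hj⟩ := (hfg.eventually_le hL).exists
  let e := Subgroup.subgroupOfEquivOfLe hj
  obtain ⟨f, hf⟩ := hli j (H.subgroupOf (L j))
    (fun h => hH (disjoint_self.1 ((Subgroup.subgroupOf_eq_bot.1 h).mono_right hj)))
    (hfg.subgroupOf hj)
  exact ⟨f.comp e.symm.toMonoidHom, hf.comp e.symm.surjective⟩

end UnionOfSubgroups

section GroupAlgebra

open MonoidAlgebra

variable {k : Type*} [DivisionRing k] {G : Type*} [Group G] {J : Type*} {U : Ultrafilter J}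
  {L : J → Subgroup G} {D : J → Type*} [∀ j, DivisionRing (D j)]

/-- The part of an element of `kG` supported on a subgroup. -/
noncomputable def MonoidAlgebra.restrictSubgroup (H : Subgroup G) :
    MonoidAlgebra k G →+ MonoidAlgebra k H :=
  comapDomainAddMonoidHom H.subtype H.subtype_injective

lemma MonoidAlgebra.restrictSubgroup_mapDomain {H : Subgroup G} (x : MonoidAlgebra k H) :
    restrictSubgroup H (mapDomain H.subtype x) = x := by
  refine mapDomain_injective H.subtype_injective (mapDomain_comapDomain ?_ H.subtype_injective)
  classical
  exact (Finset.coe_subset.2 Finsupp.mapDomain_support).trans (by simp +contextual [Set.subset_def])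

lemma MonoidAlgebra.eventually_mapDomain_restrictSubgroup {l : Filter J}
    (hL : ∀ g, ∀ᶠ j in l, g ∈ L j) (x : MonoidAlgebra k G) :
    ∀ᶠ j in l, mapDomain (L j).subtype (restrictSubgroup (L j) x) = x := by
  filter_upwards [(eventually_all_finset x.coeff.support).2 fun g _ => hL g] with j hj
  exact mapDomain_comapDomain (fun g hg => ⟨⟨g, hj g hg⟩, rfl⟩) (L j).subtype_injective

/-- The homomorphism from `kG` to an ultraproduct induced by homomorphisms on the group algebras
of subgroups that eventually contain every element of `G`. -/
noncomputable def toUltraproduct (hL : ∀ g, ∀ᶠ j in U, g ∈ L j)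
    (φ : ∀ j, MonoidAlgebra k (L j) →+* D j) : MonoidAlgebra k G →+* Ultraproduct U D where
  toFun x := Ultraproduct.mk U fun j => φ j (restrictSubgroup (L j) x)
  map_zero' := by simp only [map_zero]; exact map_zero (Ultraproduct.mk U)
  map_add' x y := by simp only [map_add]; exact map_add (Ultraproduct.mk U) _ _
  map_one' := by
    rw [← map_one (Ultraproduct.mk U), Ultraproduct.mk_eq_mk]
    refine Eventually.of_forall fun j => ?_
    have := restrictSubgroup_mapDomain (k := k) (H := L j) 1
    rw [mapDomain_one] at this
    simp [this]
  map_mul' x y := by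
    rw [← map_mul, Ultraproduct.mk_eq_mk]
    filter_upwards [eventually_mapDomain_restrictSubgroup hL x,
      eventually_mapDomain_restrictSubgroup hL y] with j hx hy
    conv_lhs => rw [← hx, ← hy, ← mapDomain_mul, restrictSubgroup_mapDomain, map_mul]
    rfl

variable (hL : ∀ g, ∀ᶠ j in U, g ∈ L j) {φ : ∀ j, MonoidAlgebra k (L j) →+* D j}

lemma toUltraproduct_apply (x : MonoidAlgebra k G) :
    toUltraproduct hL φ x = Ultraproduct.mk U fun j => φ j (restrictSubgroup (L j) x) := rfl

lemma toUltraproduct_injective (hφ : ∀ j, Function.Injective (φ j)) :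
    Function.Injective (toUltraproduct hL φ) := by
  rw [injective_iff_map_eq_zero]
  intro x hx
  rw [toUltraproduct_apply, Ultraproduct.mk_eq_zero] at hx
  obtain ⟨j, h1, h2⟩ := (hx.and (eventually_mapDomain_restrictSubgroup hL x)).exists
  rw [← h2, (map_eq_zero_iff _ (hφ j)).1 h1, mapDomain_zero]

lemma hughesIndependent_toUltraproduct (hφ : ∀ j, HughesIndependent (φ j)) :
    HughesIndependent (toUltraproduct hL φ) := by
  rintro H hH K t ⟨f, hf, rfl, hft⟩ c hc hsum
  let e (j : J) : H.subgroupOf (L j) →* H :=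
    { toFun x := ⟨x.1.1, x.2⟩, map_one' := rfl, map_mul' _ _ := rfl }
  let C (j : J) : Subring (D j) := divisionClosure (Set.range ((φ j).comp
    (mapDomainRingHom k ((H.subgroupOf (L j)).subtype.comp (f.comp (e j)).ker.subtype))))
  have hC (z : MonoidAlgebra k f.ker) : ∀ᶠ j in U, φ j (restrictSubgroup (L j)
      (mapDomainRingHom k (H.subtype.comp f.ker.subtype) z)) ∈ C j := by
    filter_upwards [hH.eventually_le hL] with j hj
    let r : f.ker →* (f.comp (e j)).ker :=
      { toFun x := ⟨⟨⟨x, hj x.1.2⟩, x.1.2⟩, x.2⟩, map_one' := rfl, map_mul' _ _ := rfl }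
    refine subset_divisionClosure _ ⟨mapDomainRingHom k r z, congrArg (φ j) ?_⟩
    rw [← restrictSubgroup_mapDomain (H := L j) (mapDomainRingHom _ _ _)]
    change restrictSubgroup (L j) (mapDomainRingHom k (L j).subtype _) = _
    congr 1
    simp only [← RingHom.comp_apply, ← mapDomainRingHom_comp]
    rfl
  have hmem (i : ℤ) : c i ∈ Ultraproduct.subring U C := by
    refine divisionClosure_le (Ultraproduct.isDivisionSubring_subring fun j =>
      isDivisionSubring_divisionClosure _) ?_ (hc i)
    rintro _ ⟨z, rfl⟩
    exact Ultraproduct.mk_mem_subring (hC z)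
  choose d hdC hd using hmem
  have hrel : ∀ᶠ j in U, ∑ i ∈ c.support,
      d i j * φ j (restrictSubgroup (L j) (of k G t)) ^ i = 0 := by
    simp only [Finsupp.sum, ringZPow_eq_zpow, ← hd, toUltraproduct_apply,
      ← Ultraproduct.mk_zpow, ← map_mul, ← map_sum] at hsum
    simpa using Ultraproduct.mk_eq_zero.1 hsum
  have hzero : ∀ᶠ j in U, ∀ i ∈ c.support, d i j = 0 := by
    filter_upwards [hrel, hH.eventually_le hL] with j hj hle
    classical
    let cj : ℤ →₀ D j := Finsupp.onFinset c.support
      (fun i => if i ∈ c.support then d i j else 0) (by simp +contextual)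
    have hcj : ∀ i ∈ c.support, cj i = d i j := fun i hi => if_pos hi
    let tj : H.subgroupOf (L j) := ⟨⟨t, hle t.2⟩, t.2⟩
    have htj : restrictSubgroup (L j) (of k G t) = of k (L j) tj := by
      rw [← restrictSubgroup_mapDomain (of k (L j) tj)]
      simp [tj]
    have hsurj : Function.Surjective (e j) := fun x => ⟨⟨⟨x, hle x.2⟩, x.2⟩, rfl⟩
    have := hφ j (H.subgroupOf (L j)) (hH.subgroupOf hle) _ tj
      ⟨f.comp (e j), hf.comp hsurj, rfl, hft⟩ cj (fun i => ?_) ?_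
    · intro i hi
      rw [← hcj i hi, this, Finsupp.zero_apply]
    · change (if i ∈ c.support then d i j else 0) ∈ C j
      split_ifs
      exacts [hdC i j, zero_mem _]
    · rw [Finsupp.onFinset_sum _ (by simp), ← hj]
      refine Finset.sum_congr rfl fun i hi => ?_
      rw [if_pos hi, ringZPow_eq_zpow, htj]
      rfl
  ext i
  by_contra hi
  refine hi ((hd i).symm.trans (Ultraproduct.mk_eq_zero.2 ?_))
  filter_upwards [hzero] with j hj using hj i (Finsupp.mem_support_iff.2 hi)

end GroupAlgebra

/-- Let `G` be the union of a directed family `(G i)` of subgroups.  If each `G i` is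
locally indicable and each group algebra `k[G i]` admits a Hughes-free embedding into a
division ring, then `G` is locally indicable and `kG` admits a Hughes-free embedding
into a division ring. -/
theorem hughesFree_of_directed_union
    {k : Type u} [DivisionRing k] {G : Type v} [Group G]
    {ι : Type w} (Gi : ι → Subgroup G)
    (hdir : ∀ i j, ∃ l, Gi i ≤ Gi l ∧ Gi j ≤ Gi l)
    (hunion : ∀ g : G, ∃ i, g ∈ Gi i)
    (hli : ∀ i, LocallyIndicable (Gi i))
    (hHF : ∀ i, ∃ (Di : Type (max u v)) (_ : DivisionRing Di)
      (φi : MonoidAlgebra k (Gi i) →+* Di), IsHughesFreeEmbedding φi) :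
    LocallyIndicable G ∧
      ∃ (D : Type (max u v)) (_ : DivisionRing D)
        (φ : MonoidAlgebra k G →+* D), IsHughesFreeEmbedding φ := by
  let J := Set.range Gi
  obtain ⟨i₀, -⟩ := hunion 1
  have : Nonempty J := ⟨⟨Gi i₀, i₀, rfl⟩⟩
  have : IsDirectedOrder J := ⟨by
    rintro ⟨_, i, rfl⟩ ⟨_, j, rfl⟩
    obtain ⟨l, hl⟩ := hdir i j
    exact ⟨⟨Gi l, l, rfl⟩, hl⟩⟩
  let U : Ultrafilter J := Ultrafilter.of atTop
  have hL (g : G) : ∀ᶠ H : J in U, g ∈ H.1 := by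
    obtain ⟨i, hi⟩ := hunion g
    exact ((eventually_ge_atTop (⟨Gi i, i, rfl⟩ : J)).mono fun H hH => hH hi).filter_mono
      (Ultrafilter.of_le _)
  have hHF' (H : J) : ∃ (D : Type (max u v)) (_ : DivisionRing D)
      (φ : MonoidAlgebra k H.1 →+* D), IsHughesFreeEmbedding φ := by
    obtain ⟨_, i, rfl⟩ := H
    exact hHF i
  choose D hD φ hφ using hHF'
  refine ⟨LocallyIndicable.of_eventually_mem hL ?_, ?_⟩
  · rintro ⟨_, i, rfl⟩
    exact hli i
  · exact (hughesIndependent_toUltraproduct hL fun H => (hφ H).2.2).exists_isHughesFreeEmbedding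
      (toUltraproduct_injective hL fun H => (hφ H).1)
end
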